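/- arXiv:math/0504299 — 5 statements merged into one kernel-verified Lean document; each statement's English description precedes it below -/
import Mathlib

section
/- Let T ⊆ ℤ² be a grid whose convex hull is 2-dimensional, let f : T → ℝ, and let f̃ : conv(T) → ℝ be the piecewise-affine interpolation of f with respect to the triangulation of conv(T) by primitive triangles. Then f̃ is concave on conv(T) if and only if f satisfies all three types of rhombus inequalities on T: (i) f(i,j) + f(i+1,j+1) ≥ f(i+1,j) + f(i,j+1); (ii) f(i,j+1) + f(i+1,j+1) ≥ f(i+1,j+2) + f(i,j); (iii) f(i+1,j) + f(i+1,j+1) ≥ f(i,j) + f(i+2,j+1), each required whenever all four points involved lie in T. -/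
/-- Points of the plane lattice. -/
abbrev V2 : Type := ℤ × ℤ

/-- `f` satisfies, on `S`, the three types of rhombus inequalities (i), (ii), (iii)
(each required whenever all four points involved lie in `S`). -/
def DC2On (S : Set V2) (f : V2 → ℝ) : Prop :=
  (∀ i j : ℤ, (i, j) ∈ S → (i + 1, j) ∈ S → (i, j + 1) ∈ S → (i + 1, j + 1) ∈ S →
    f (i, j) + f (i + 1, j + 1) ≥ f (i + 1, j) + f (i, j + 1)) ∧
  (∀ i j : ℤ, (i, j) ∈ S → (i, j + 1) ∈ S → (i + 1, j + 1) ∈ S → (i + 1, j + 2) ∈ S →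
    f (i, j + 1) + f (i + 1, j + 1) ≥ f (i + 1, j + 2) + f (i, j)) ∧
  (∀ i j : ℤ, (i, j) ∈ S → (i + 1, j) ∈ S → (i + 1, j + 1) ∈ S → (i + 2, j + 1) ∈ S →
    f (i + 1, j) + f (i + 1, j + 1) ≥ f (i, j) + f (i + 2, j + 1))

/-- The embedding of the lattice `ℤ²` into `ℝ²`. -/
def toR2 (q : V2) : ℝ × ℝ := ((q.1 : ℝ), (q.2 : ℝ))

/-- `ft` is affine on the convex hull of the triangle with vertices `p`, `q`, `r`. -/
def AffOnTri (ft : ℝ × ℝ → ℝ) (p q r : V2) : Prop :=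
  ∃ α β γ : ℝ, ∀ x ∈ convexHull ℝ ({toR2 p, toR2 q, toR2 r} : Set (ℝ × ℝ)),
    ft x = α * x.1 + β * x.2 + γ

/-- The lower right primitive triangle of the unit square at `(i, j)` is contained in `T`. -/
def UpTri (T : Set V2) (i j : ℤ) : Prop :=
  (i, j) ∈ T ∧ (i + 1, j) ∈ T ∧ (i + 1, j + 1) ∈ T

/-- The upper left primitive triangle of the unit square at `(i, j)` is contained in `T`. -/
def DownTri (T : Set V2) (i j : ℤ) : Prop :=
  (i, j) ∈ T ∧ (i, j + 1) ∈ T ∧ (i + 1, j + 1) ∈ T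

/-- The lower right closed half of the unit square at `(i, j)`. -/
def upCell (i j : ℤ) : Set (ℝ × ℝ) := {x | (j : ℝ) ≤ x.2 ∧ x.1 ≤ i + 1 ∧ x.2 - x.1 ≤ j - i}

/-- The upper left closed half of the unit square at `(i, j)`. -/
def downCell (i j : ℤ) : Set (ℝ × ℝ) := {x | (i : ℝ) ≤ x.1 ∧ x.2 ≤ j + 1 ∧ (j : ℝ) - i ≤ x.2 - x.1}

/-- The affine function that agrees with `f` on the vertices of `upCell i j`. -/
def upPlane (f : V2 → ℝ) (i j : ℤ) (x : ℝ × ℝ) : ℝ :=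
  f (i, j) + (x.1 - i) * (f (i + 1, j) - f (i, j)) + (x.2 - j) * (f (i + 1, j + 1) - f (i + 1, j))

/-- The affine function that agrees with `f` on the vertices of `downCell i j`. -/
def downPlane (f : V2 → ℝ) (i j : ℤ) (x : ℝ × ℝ) : ℝ :=
  f (i, j) + (x.1 - i) * (f (i + 1, j + 1) - f (i, j + 1)) + (x.2 - j) * (f (i, j + 1) - f (i, j))

/-- The lattice points of the polygon cut out by the six given bounds. -/
def latticeGrid (a₁ a₂ b₁ b₂ c₁ c₂ : ℤ) : Set V2 :=
  {q | a₁ ≤ q.1 ∧ q.1 ≤ a₂ ∧ b₁ ≤ q.2 ∧ q.2 ≤ b₂ ∧ c₁ ≤ q.2 - q.1 ∧ q.2 - q.1 ≤ c₂}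

/-- The real polygon cut out by the six given bounds. -/
def realGrid (a₁ a₂ b₁ b₂ c₁ c₂ : ℤ) : Set (ℝ × ℝ) :=
  {x | a₁ ≤ x.1 ∧ x.1 ≤ a₂ ∧ b₁ ≤ x.2 ∧ x.2 ≤ b₂ ∧ c₁ ≤ x.2 - x.1 ∧ x.2 - x.1 ≤ c₂}

theorem convexHull_latticeGrid_subset (a₁ a₂ b₁ b₂ c₁ c₂ : ℤ) :
    convexHull ℝ (toR2 '' latticeGrid a₁ a₂ b₁ b₂ c₁ c₂) ⊆ realGrid a₁ a₂ b₁ b₂ c₁ c₂ := by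
  refine convexHull_min ?_ ?_
  · rintro _ ⟨q, ⟨h1, h2, h3, h4, h5, h6⟩, rfl⟩
    simp only [realGrid, toR2, Set.mem_ofPred_eq]
    refine ⟨?_, ?_, ?_, ?_, ?_, ?_⟩ <;> norm_cast
  · rintro x ⟨h1, h2, h3, h4, h5, h6⟩ y ⟨k1, k2, k3, k4, k5, k6⟩ s t hs ht hst
    obtain rfl : t = 1 - s := by linarith
    simp only [realGrid, Set.mem_ofPred_eq, Prod.fst_add, Prod.snd_add, Prod.smul_fst,
      Prod.smul_snd, smul_eq_mul]
    refine ⟨?_, ?_, ?_, ?_, ?_, ?_⟩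
    · nlinarith [mul_le_mul_of_nonneg_left h1 hs, mul_le_mul_of_nonneg_left k1 ht]
    · nlinarith [mul_le_mul_of_nonneg_left h2 hs, mul_le_mul_of_nonneg_left k2 ht]
    · nlinarith [mul_le_mul_of_nonneg_left h3 hs, mul_le_mul_of_nonneg_left k3 ht]
    · nlinarith [mul_le_mul_of_nonneg_left h4 hs, mul_le_mul_of_nonneg_left k4 ht]
    · nlinarith [mul_le_mul_of_nonneg_left h5 hs, mul_le_mul_of_nonneg_left k5 ht]
    · nlinarith [mul_le_mul_of_nonneg_left h6 hs, mul_le_mul_of_nonneg_left k6 ht]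

/-- A grid with two-dimensional convex hull contains a primitive triangle. -/
theorem exists_upTri_or_downTri {a₁ a₂ b₁ b₂ c₁ c₂ : ℤ}
    (hdim : affineSpan ℝ (toR2 '' latticeGrid a₁ a₂ b₁ b₂ c₁ c₂) = ⊤) :
    ∃ i j, UpTri (latticeGrid a₁ a₂ b₁ b₂ c₁ c₂) i j ∨
      DownTri (latticeGrid a₁ a₂ b₁ b₂ c₁ c₂) i j := by
  obtain ⟨z, hz⟩ := interior_convexHull_nonempty_iff_affineSpan_eq_top.mpr hdim
  obtain ⟨ε, hε, hball⟩ := Metric.mem_nhds_iff.mp (mem_interior_iff_mem_nhds.mp hz)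
  have key (s t : ℝ) (hs : |s| < ε) (ht : |t| < ε) :
      (z.1 + s, z.2 + t) ∈ realGrid a₁ a₂ b₁ b₂ c₁ c₂ := by
    refine convexHull_latticeGrid_subset _ _ _ _ _ _ (hball ?_)
    simp [Prod.dist_eq, hs, ht]
  have hpos : |ε / 2| < ε := by rw [abs_of_pos] <;> linarith
  have hneg : |-(ε / 2)| < ε := by rwa [abs_neg]
  have hzero : |(0 : ℝ)| < ε := by simpa using hε
  obtain ⟨-, h1, -, -, h2, -⟩ := key _ _ hpos hzero
  obtain ⟨h3, -, -, -, -, h4⟩ := key _ _ hneg hzero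
  obtain ⟨-, -, -, h5, -, -⟩ := key _ _ hzero hpos
  obtain ⟨-, -, h6, -, -, -⟩ := key _ _ hzero hneg
  simp only at h1 h2 h3 h4 h5 h6
  have ha₁ : a₁ ≤ ⌊z.1⌋ := Int.le_floor.mpr (by linarith)
  have ha₂ : ⌊z.1⌋ < a₂ := Int.floor_lt.mpr (by linarith)
  have hb₁ : b₁ ≤ ⌊z.2⌋ := Int.le_floor.mpr (by linarith)
  have hb₂ : ⌊z.2⌋ < b₂ := Int.floor_lt.mpr (by linarith)
  have hc₁ : c₁ ≤ ⌊z.2 - z.1⌋ := Int.le_floor.mpr (by linarith)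
  have hc₂ : ⌊z.2 - z.1⌋ < c₂ := Int.floor_lt.mpr (by linarith)
  have hx := Int.floor_le z.1
  have hx' := Int.lt_floor_add_one z.1
  have hy := Int.floor_le z.2
  have hy' := Int.lt_floor_add_one z.2
  refine ⟨⌊z.1⌋, ⌊z.2⌋, ?_⟩
  rcases lt_or_ge (z.2 - z.1) (⌊z.2⌋ - ⌊z.1⌋) with h | h
  · have : ⌊z.2 - z.1⌋ = ⌊z.2⌋ - ⌊z.1⌋ - 1 := by
      rw [Int.floor_eq_iff]; push_cast; constructor <;> linarith
    left
    simp only [UpTri, latticeGrid, Set.mem_ofPred_eq]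
    omega
  · have : ⌊z.2 - z.1⌋ = ⌊z.2⌋ - ⌊z.1⌋ := by
      rw [Int.floor_eq_iff]; push_cast; constructor <;> linarith
    right
    simp only [DownTri, latticeGrid, Set.mem_ofPred_eq]
    omega

/-- Induction over the primitive triangles of a grid, walking towards the point `x`: from a
triangle that does not contain `x`, one may cross any edge whose line separates it from `x`. -/
theorem triangle_induction {a₁ a₂ b₁ b₂ c₁ c₂ : ℤ} {T : Set V2}
    (hT : T = latticeGrid a₁ a₂ b₁ b₂ c₁ c₂) {x : ℝ × ℝ} (hx : x ∈ realGrid a₁ a₂ b₁ b₂ c₁ c₂)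
    (up down : ℤ → ℤ → Prop)
    (up_mem : ∀ i j, UpTri T i j → x ∈ upCell i j → up i j)
    (down_mem : ∀ i j, DownTri T i j → x ∈ downCell i j → down i j)
    (up_bottom : ∀ i j, UpTri T i (j + 1) → DownTri T i j → x.2 < j + 1 → down i j → up i (j + 1))
    (up_right : ∀ i j, UpTri T i j → DownTri T (i + 1) j → i + 1 < x.1 → down (i + 1) j → up i j)
    (up_diag : ∀ i j, UpTri T i j → DownTri T i j → (j : ℝ) - i < x.2 - x.1 → down i j → up i j)
    (down_top : ∀ i j, DownTri T i j → UpTri T i (j + 1) → j + 1 < x.2 → up i (j + 1) → down i j)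
    (down_left : ∀ i j, DownTri T (i + 1) j → UpTri T i j → x.1 < i + 1 → up i j → down (i + 1) j)
    (down_diag : ∀ i j, DownTri T i j → UpTri T i j → x.2 - x.1 < j - i → up i j → down i j)
    (i j : ℤ) : (UpTri T i j → up i j) ∧ (DownTri T i j → down i j) := by
  subst hT
  obtain ⟨ha₁, ha₂, hb₁, hb₂, hc₁, hc₂⟩ := hx
  let μ (k : ℤ) (t : ℝ) : ℕ := (k - ⌊t⌋).toNat + (⌈t⌉ - 1 - k).toNat
  have μ_lt_of_lt {k : ℤ} {t : ℝ} (h : t < k) : μ (k - 1) t < μ k t := by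
    have h1 : ⌊t⌋ < k := Int.floor_lt.mpr h
    have h2 : ⌈t⌉ ≤ k := Int.ceil_le.mpr h.le
    simp only [μ]
    omega
  have μ_lt_of_gt {k : ℤ} {t : ℝ} (h : k + 1 < t) : μ (k + 1) t < μ k t := by
    have h1 : k + 1 < ⌈t⌉ := Int.lt_ceil.mpr (by exact_mod_cast h)
    have h2 : k + 1 ≤ ⌊t⌋ := Int.le_floor.mpr (by exact_mod_cast h.le)
    simp only [μ]
    omega
  suffices h : ∀ n : ℕ, ∀ i j : ℤ,
      (UpTri (latticeGrid a₁ a₂ b₁ b₂ c₁ c₂) i j →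
        μ i x.1 + μ j x.2 + μ (j - i - 1) (x.2 - x.1) ≤ n → up i j) ∧
      (DownTri (latticeGrid a₁ a₂ b₁ b₂ c₁ c₂) i j →
        μ i x.1 + μ j x.2 + μ (j - i) (x.2 - x.1) ≤ n → down i j) from
    ⟨fun hu => (h _ i j).1 hu le_rfl, fun hd => (h _ i j).2 hd le_rfl⟩
  intro n
  induction n using Nat.strong_induction_on with
  | _ n ih =>
  intro i j
  constructor
  · intro hu hn
    by_cases h1 : x.2 < j
    · have hb : b₁ < j := by exact_mod_cast hb₁.trans_lt h1
      have hμ := μ_lt_of_lt h1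
      obtain ⟨j, rfl⟩ : ∃ l, j = l + 1 := ⟨j - 1, by ring⟩
      have hd : DownTri (latticeGrid a₁ a₂ b₁ b₂ c₁ c₂) i j := by
        simp only [UpTri, DownTri, latticeGrid, Set.mem_ofPred_eq] at hu ⊢
        omega
      rw [add_sub_cancel_right] at hμ
      rw [show j + 1 - i - 1 = j - i by ring] at hn
      exact up_bottom i j hu hd (by exact_mod_cast h1) ((ih _ (by omega) i j).2 hd le_rfl)
    by_cases h2 : i + 1 < x.1
    · have ha : i + 1 < a₂ := by exact_mod_cast h2.trans_le ha₂
      have hμ := μ_lt_of_gt h2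
      have hd : DownTri (latticeGrid a₁ a₂ b₁ b₂ c₁ c₂) (i + 1) j := by
        simp only [UpTri, DownTri, latticeGrid, Set.mem_ofPred_eq] at hu ⊢
        omega
      rw [show j - i - 1 = j - (i + 1) by ring] at hn
      exact up_right i j hu hd h2 ((ih _ (by omega) (i + 1) j).2 hd le_rfl)
    by_cases h3 : (j : ℝ) - i < x.2 - x.1
    · have hc : j - i < c₂ := by exact_mod_cast h3.trans_le hc₂
      have hμ := μ_lt_of_gt (k := j - i - 1) (t := x.2 - x.1) (by push_cast; linarith)
      have hd : DownTri (latticeGrid a₁ a₂ b₁ b₂ c₁ c₂) i j := by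
        simp only [UpTri, DownTri, latticeGrid, Set.mem_ofPred_eq] at hu ⊢
        omega
      rw [sub_add_cancel] at hμ
      exact up_diag i j hu hd h3 ((ih _ (by omega) i j).2 hd le_rfl)
    exact up_mem i j hu ⟨not_lt.mp h1, not_lt.mp h2, not_lt.mp h3⟩
  · intro hd hn
    by_cases h1 : x.1 < i
    · have ha : a₁ < i := by exact_mod_cast ha₁.trans_lt h1
      have hμ := μ_lt_of_lt h1
      obtain ⟨i, rfl⟩ : ∃ k, i = k + 1 := ⟨i - 1, by ring⟩
      have hu : UpTri (latticeGrid a₁ a₂ b₁ b₂ c₁ c₂) i j := by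
        simp only [UpTri, DownTri, latticeGrid, Set.mem_ofPred_eq] at hd ⊢
        omega
      rw [add_sub_cancel_right] at hμ
      rw [show j - (i + 1) = j - i - 1 by ring] at hn
      exact down_left i j hd hu (by exact_mod_cast h1) ((ih _ (by omega) i j).1 hu le_rfl)
    by_cases h2 : j + 1 < x.2
    · have hb : j + 1 < b₂ := by exact_mod_cast h2.trans_le hb₂
      have hμ := μ_lt_of_gt h2
      have hu : UpTri (latticeGrid a₁ a₂ b₁ b₂ c₁ c₂) i (j + 1) := by
        simp only [UpTri, DownTri, latticeGrid, Set.mem_ofPred_eq] at hd ⊢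
        omega
      rw [show j - i = j + 1 - i - 1 by ring] at hn
      exact down_top i j hd hu h2 ((ih _ (by omega) i (j + 1)).1 hu le_rfl)
    by_cases h3 : x.2 - x.1 < j - i
    · have hc : c₁ < j - i := by exact_mod_cast hc₁.trans_lt h3
      have hμ := μ_lt_of_lt (k := j - i) (t := x.2 - x.1) (by push_cast; linarith)
      have hu : UpTri (latticeGrid a₁ a₂ b₁ b₂ c₁ c₂) i j := by
        simp only [UpTri, DownTri, latticeGrid, Set.mem_ofPred_eq] at hd ⊢
        omega
      exact down_diag i j hd hu h3 ((ih _ (by omega) i j).1 hu le_rfl)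
    exact down_mem i j hd ⟨not_lt.mp h1, not_lt.mp h2, not_lt.mp h3⟩

/-- Every point of the polygon of a two-dimensional grid lies in a primitive triangle. -/
theorem exists_mem_cell {a₁ a₂ b₁ b₂ c₁ c₂ : ℤ} {T : Set V2}
    (hT : T = latticeGrid a₁ a₂ b₁ b₂ c₁ c₂) (hdim : affineSpan ℝ (toR2 '' T) = ⊤)
    {x : ℝ × ℝ} (hx : x ∈ realGrid a₁ a₂ b₁ b₂ c₁ c₂) :
    ∃ i j, UpTri T i j ∧ x ∈ upCell i j ∨ DownTri T i j ∧ x ∈ downCell i j := by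
  obtain ⟨i, j, h⟩ := exists_upTri_or_downTri (hT ▸ hdim)
  have key := triangle_induction hT hx
    (fun _ _ => ∃ i j, UpTri T i j ∧ x ∈ upCell i j ∨ DownTri T i j ∧ x ∈ downCell i j)
    (fun _ _ => ∃ i j, UpTri T i j ∧ x ∈ upCell i j ∨ DownTri T i j ∧ x ∈ downCell i j)
    (fun i j h h' => ⟨i, j, .inl ⟨h, h'⟩⟩) (fun i j h h' => ⟨i, j, .inr ⟨h, h'⟩⟩)
    (fun _ _ _ _ _ => id) (fun _ _ _ _ _ => id) (fun _ _ _ _ _ => id)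
    (fun _ _ _ _ _ => id) (fun _ _ _ _ _ => id) (fun _ _ _ _ _ => id) i j
  rw [← hT] at h
  exact h.elim key.1 key.2

/-- If `f` satisfies the rhombus inequalities, the affine function belonging to any primitive
triangle lies above the interpolation of `f`. -/
theorem le_planes_of_DC2On {a₁ a₂ b₁ b₂ c₁ c₂ : ℤ} {T : Set V2} {f : V2 → ℝ}
    (hT : T = latticeGrid a₁ a₂ b₁ b₂ c₁ c₂) (hf : DC2On T f)
    {x : ℝ × ℝ} (hx : x ∈ realGrid a₁ a₂ b₁ b₂ c₁ c₂) {v : ℝ}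
    (hup : ∀ i j, UpTri T i j → x ∈ upCell i j → v ≤ upPlane f i j x)
    (hdown : ∀ i j, DownTri T i j → x ∈ downCell i j → v ≤ downPlane f i j x) (i j : ℤ) :
    (UpTri T i j → v ≤ upPlane f i j x) ∧ (DownTri T i j → v ≤ downPlane f i j x) := by
  obtain ⟨hf1, hf2, hf3⟩ := hf
  have two (k : ℤ) : k + 1 + 1 = k + 2 := by ring
  apply triangle_induction hT hx (fun i j => v ≤ upPlane f i j x) (fun i j => v ≤ downPlane f i j x)
    hup hdown
  · rintro i j ⟨-, -, h3⟩ ⟨k1, k2, k3⟩ hlt hle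
    have := hf2 i j k1 k2 k3 (two j ▸ h3)
    simp only [upPlane, downPlane, two] at hle ⊢
    push_cast
    nlinarith
  · rintro i j ⟨h1, h2, h3⟩ ⟨-, -, k3⟩ hlt hle
    have := hf3 i j h1 h2 h3 (two i ▸ k3)
    simp only [upPlane, downPlane, two] at hle ⊢
    push_cast at hle
    nlinarith
  · rintro i j ⟨h1, h2, h3⟩ ⟨-, k2, -⟩ hlt hle
    have := hf1 i j h1 h2 k2 h3
    simp only [upPlane, downPlane] at hle ⊢
    nlinarith
  · rintro i j ⟨k1, k2, k3⟩ ⟨-, -, h3⟩ hlt hle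
    have := hf2 i j k1 k2 k3 (two j ▸ h3)
    simp only [upPlane, downPlane, two] at hle ⊢
    push_cast at hle
    nlinarith
  · rintro i j ⟨-, -, k3⟩ ⟨h1, h2, h3⟩ hlt hle
    have := hf3 i j h1 h2 h3 (two i ▸ k3)
    simp only [upPlane, downPlane, two] at hle ⊢
    push_cast
    nlinarith
  · rintro i j ⟨-, k2, -⟩ ⟨h1, h2, h3⟩ hlt hle
    have := hf1 i j h1 h2 k2 h3
    simp only [upPlane, downPlane] at hle ⊢
    nlinarith

theorem add_add_smul_mem_convexHull_triple {E : Type*} [AddCommGroup E] [Module ℝ E] (p q r : E)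
    {a b c : ℝ} (ha : 0 ≤ a) (hb : 0 ≤ b) (hc : 0 ≤ c) (habc : a + b + c = 1) :
    a • p + b • q + c • r ∈ convexHull ℝ ({p, q, r} : Set E) := by
  have h := (convex_convexHull ℝ ({p, q, r} : Set E)).sum_mem (t := Finset.univ)
    (w := ![a, b, c]) (z := ![p, q, r])
    (by simp [Fin.forall_fin_succ, ha, hb, hc]) (by simp [Fin.sum_univ_three, habc])
    (fun i _ => subset_convexHull _ _ (by fin_cases i <;> simp))
  simpa [Fin.sum_univ_three] using h

theorem upCell_subset_convexHull (i j : ℤ) :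
    upCell i j ⊆ convexHull ℝ {toR2 (i, j), toR2 (i + 1, j), toR2 (i + 1, j + 1)} := by
  rintro ⟨x, y⟩ ⟨h1, h2, h3⟩
  simp only at h1 h2 h3
  convert add_add_smul_mem_convexHull_triple (toR2 (i, j)) (toR2 (i + 1, j)) (toR2 (i + 1, j + 1))
    (a := 1 - (x - i)) (b := (x - i) - (y - j)) (c := y - j) (by linarith) (by linarith)
    (by linarith) (by ring) using 1
  ext <;> simp [toR2] <;> ring

theorem downCell_subset_convexHull (i j : ℤ) :
    downCell i j ⊆ convexHull ℝ {toR2 (i, j), toR2 (i, j + 1), toR2 (i + 1, j + 1)} := by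
  rintro ⟨x, y⟩ ⟨h1, h2, h3⟩
  simp only at h1 h2 h3
  convert add_add_smul_mem_convexHull_triple (toR2 (i, j)) (toR2 (i, j + 1)) (toR2 (i + 1, j + 1))
    (a := 1 - (y - j)) (b := (y - j) - (x - i)) (c := x - i) (by linarith) (by linarith)
    (by linarith) (by ring) using 1
  ext <;> simp [toR2] <;> ring

theorem AffOnTri.eq_upPlane {ft : ℝ × ℝ → ℝ} {f : V2 → ℝ} {i j : ℤ}
    (h : AffOnTri ft (i, j) (i + 1, j) (i + 1, j + 1)) (h1 : ft (toR2 (i, j)) = f (i, j))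
    (h2 : ft (toR2 (i + 1, j)) = f (i + 1, j))
    (h3 : ft (toR2 (i + 1, j + 1)) = f (i + 1, j + 1)) {x : ℝ × ℝ} (hx : x ∈ upCell i j) :
    ft x = upPlane f i j x := by
  obtain ⟨α, β, γ, h⟩ := h
  rw [h _ (subset_convexHull _ _ (by simp))] at h1 h2 h3
  rw [h x (upCell_subset_convexHull i j hx)]
  simp only [upPlane, ← h1, ← h2, ← h3, toR2]
  push_cast
  ring

theorem AffOnTri.eq_downPlane {ft : ℝ × ℝ → ℝ} {f : V2 → ℝ} {i j : ℤ}
    (h : AffOnTri ft (i, j) (i, j + 1) (i + 1, j + 1)) (h1 : ft (toR2 (i, j)) = f (i, j))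
    (h2 : ft (toR2 (i, j + 1)) = f (i, j + 1))
    (h3 : ft (toR2 (i + 1, j + 1)) = f (i + 1, j + 1)) {x : ℝ × ℝ} (hx : x ∈ downCell i j) :
    ft x = downPlane f i j x := by
  obtain ⟨α, β, γ, h⟩ := h
  rw [h _ (subset_convexHull _ _ (by simp))] at h1 h2 h3
  rw [h x (downCell_subset_convexHull i j hx)]
  simp only [downPlane, ← h1, ← h2, ← h3, toR2]
  push_cast
  ring

theorem upPlane_combo (f : V2 → ℝ) (i j : ℤ) (x y : ℝ × ℝ) {s t : ℝ} (hst : s + t = 1) :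
    upPlane f i j (s • x + t • y) = s * upPlane f i j x + t * upPlane f i j y := by
  obtain rfl : t = 1 - s := by linarith
  simp only [upPlane, Prod.fst_add, Prod.snd_add, Prod.smul_fst, Prod.smul_snd, smul_eq_mul]
  ring

theorem downPlane_combo (f : V2 → ℝ) (i j : ℤ) (x y : ℝ × ℝ) {s t : ℝ} (hst : s + t = 1) :
    downPlane f i j (s • x + t • y) = s * downPlane f i j x + t * downPlane f i j y := by
  obtain rfl : t = 1 - s := by linarith
  simp only [downPlane, Prod.fst_add, Prod.snd_add, Prod.smul_fst, Prod.smul_snd, smul_eq_mul]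
  ring

/-- let `T` be a grid (a finite nonempty lattice-convex set all of whose convex
hull edges are parallel to `(1,0)`, `(0,1)`, `(1,1)`, i.e. an intersection of integer
half-planes with these normal data) whose convex hull is 2-dimensional, and let `ft` be the
piecewise-affine interpolation of `f : T → ℝ` with respect to the triangulation of `conv T` by
primitive triangles.  Then `ft` is concave on `conv T` iff `f` satisfies all three types of
rhombus inequalities on `T`. -/
theorem interpolation_concave_iff_rhombus (T : Set V2) (f : V2 → ℝ) (ft : ℝ × ℝ → ℝ)
    (hne : T.Nonempty) (hfin : T.Finite)
    (hedges : ∃ a₁ a₂ b₁ b₂ c₁ c₂ : ℤ,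
      T = {q | a₁ ≤ q.1 ∧ q.1 ≤ a₂ ∧ b₁ ≤ q.2 ∧ q.2 ≤ b₂ ∧ c₁ ≤ q.2 - q.1 ∧ q.2 - q.1 ≤ c₂})
    (hnoholes : ∀ q : V2, toR2 q ∈ convexHull ℝ (toR2 '' T) → q ∈ T)
    (hdim : affineSpan ℝ (toR2 '' T) = ⊤)
    (hagree : ∀ q ∈ T, ft (toR2 q) = f q)
    (haff₁ : ∀ p : V2, p ∈ T → p + (0, 1) ∈ T → p + (1, 1) ∈ T →
      AffOnTri ft p (p + (0, 1)) (p + (1, 1)))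
    (haff₂ : ∀ p : V2, p ∈ T → p + (1, 0) ∈ T → p + (1, 1) ∈ T →
      AffOnTri ft p (p + (1, 0)) (p + (1, 1))) :
    ConcaveOn ℝ (convexHull ℝ (toR2 '' T)) ft ↔ DC2On T f := by
  obtain ⟨a₁, a₂, b₁, b₂, c₁, c₂, hT⟩ := hedges
  change T = latticeGrid a₁ a₂ b₁ b₂ c₁ c₂ at hT
  have hup (i j : ℤ) (h : UpTri T i j) (x : ℝ × ℝ) (hx : x ∈ upCell i j) :
      ft x = upPlane f i j x := by
    obtain ⟨h1, h2, h3⟩ := h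
    have := haff₂ (i, j) h1
    simp only [Prod.mk_add_mk, add_zero] at this
    exact (this h2 h3).eq_upPlane (hagree _ h1) (hagree _ h2) (hagree _ h3) hx
  have hdown (i j : ℤ) (h : DownTri T i j) (x : ℝ × ℝ) (hx : x ∈ downCell i j) :
      ft x = downPlane f i j x := by
    obtain ⟨h1, h2, h3⟩ := h
    have := haff₁ (i, j) h1
    simp only [Prod.mk_add_mk, add_zero] at this
    exact (this h2 h3).eq_downPlane (hagree _ h1) (hagree _ h2) (hagree _ h3) hx
  constructor
  · intro hconc
    have mid (p q : V2) (hp : p ∈ T) (hq : q ∈ T) :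
        (f p + f q) / 2 ≤ ft (((p.1 : ℝ) + q.1) / 2, ((p.2 : ℝ) + q.2) / 2) := by
      have h := hconc.2 (subset_convexHull _ _ ⟨p, hp, rfl⟩) (subset_convexHull _ _ ⟨q, hq, rfl⟩)
        (show (0 : ℝ) ≤ 1 / 2 by norm_num) (show (0 : ℝ) ≤ 1 / 2 by norm_num) (by norm_num)
      rw [hagree p hp, hagree q hq] at h
      refine le_of_eq_of_le ?_ (h.trans_eq (congrArg ft ?_))
      · simp only [smul_eq_mul]; ring
      · ext <;> simp [toR2] <;> ring
    refine ⟨fun i j h1 h2 h3 h4 => ?_, fun i j h1 h2 h3 h4 => ?_, fun i j h1 h2 h3 h4 => ?_⟩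
    · have h := mid _ _ h2 h3
      rw [hup i j ⟨h1, h2, h4⟩ _ (by
        simp only [upCell, Set.mem_ofPred_eq]; push_cast; refine ⟨?_, ?_, ?_⟩ <;> linarith)] at h
      simp only [upPlane] at h
      push_cast at h
      ring_nf at h ⊢
      linarith
    · have h := mid _ _ h1 h4
      rw [hdown i j ⟨h1, h2, h3⟩ _ (by
        simp only [downCell, Set.mem_ofPred_eq]; push_cast; refine ⟨?_, ?_, ?_⟩ <;> linarith)] at h
      simp only [downPlane] at h
      push_cast at h
      ring_nf at h ⊢
      linarith
    · have h := mid _ _ h1 h4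
      rw [hup i j ⟨h1, h2, h3⟩ _ (by
        simp only [upCell, Set.mem_ofPred_eq]; push_cast; refine ⟨?_, ?_, ?_⟩ <;> linarith)] at h
      simp only [upPlane] at h
      push_cast at h
      ring_nf at h ⊢
      linarith
  · intro hf
    have hsub : convexHull ℝ (toR2 '' T) ⊆ realGrid a₁ a₂ b₁ b₂ c₁ c₂ :=
      hT ▸ convexHull_latticeGrid_subset a₁ a₂ b₁ b₂ c₁ c₂
    have hle {x : ℝ × ℝ} (hx : x ∈ convexHull ℝ (toR2 '' T)) :=
      le_planes_of_DC2On hT hf (hsub hx) (fun i j h h' => (hup i j h x h').le)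
        (fun i j h h' => (hdown i j h x h').le)
    refine ⟨convex_convexHull _ _, fun x hx y hy s t hs ht hst => ?_⟩
    obtain ⟨i, j, ⟨h, hz⟩ | ⟨h, hz⟩⟩ :=
      exists_mem_cell hT hdim (hsub (convex_convexHull _ _ hx hy hs ht hst))
    · rw [hup i j h _ hz, upPlane_combo f i j x y hst]
      exact add_le_add (mul_le_mul_of_nonneg_left ((hle hx i j).1 h) hs)
        (mul_le_mul_of_nonneg_left ((hle hy i j).1 h) ht)
    · rw [hdown i j h _ hz, downPlane_combo f i j x y hst]
      exact add_le_add (mul_le_mul_of_nonneg_left ((hle hx i j).2 h) hs)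
        (mul_le_mul_of_nonneg_left ((hle hy i j).2 h) ht)
end

section
/- Let n ≥ 1 and let f : Δ_n → ℝ be discrete concave on the triangular grid Δ_n. If f vanishes on the left side and on the top side of the triangle, i.e. f(0,y) = 0 for all 0 ≤ y ≤ n and f(x,n) = 0 for all 0 ≤ x ≤ n, then f is identically zero on Δ_n. -/
/-- The triangular grid `Δ_n = {(x,y) ∈ ℤ² : 0 ≤ x ≤ y ≤ n}`. -/
def Tri (n : ℕ) : Set V2 := {q | 0 ≤ q.1 ∧ q.1 ≤ q.2 ∧ q.2 ≤ (n : ℤ)}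

/-- A function satisfying the rhombus inequalities on the triangle and vanishing on the left side
does not change along vertical edges. -/
theorem DC2On.vertical_edge_eq {n : ℕ} {f : V2 → ℝ} (hf : DC2On (Tri n) f)
    (hleft : ∀ y : ℤ, 0 ≤ y → y ≤ (n : ℤ) → f (0, y) = 0) (x : ℕ) :
    ∀ y : ℤ, (x : ℤ) ≤ y → y + 1 ≤ (n : ℤ) → f ((x : ℤ), y + 1) = f ((x : ℤ), y) := by
  induction x with
  | zero =>
    intro y hxy hyn
    push_cast at hxy ⊢
    rw [hleft y hxy (by lia), hleft (y + 1) (by lia) hyn]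
  | succ x ih =>
    intro y hxy hyn
    push_cast at hxy ⊢
    have hlower := hf.1 x y (by simp only [Tri, Set.mem_ofPred_eq]; lia)
      (by simp only [Tri, Set.mem_ofPred_eq]; lia) (by simp only [Tri, Set.mem_ofPred_eq]; lia)
      (by simp only [Tri, Set.mem_ofPred_eq]; lia)
    have hupper := hf.2.1 x (y - 1) (by simp only [Tri, Set.mem_ofPred_eq]; lia)
      (by simp only [Tri, Set.mem_ofPred_eq]; lia) (by simp only [Tri, Set.mem_ofPred_eq]; lia)
      (by simp only [Tri, Set.mem_ofPred_eq]; lia)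
    have hedge := ih y (by lia) hyn
    have hedge' := ih (y - 1) (by lia) (by lia)
    rw [show y - 1 + 2 = y + 1 by ring, sub_add_cancel] at hupper
    rw [sub_add_cancel] at hedge'
    linarith

/-- a discrete concave function on `Δ_n` vanishing on the left side and on the
top side of the triangle vanishes identically. -/
theorem discrete_concave_zero_boundary (n : ℕ) (hn : 1 ≤ n) (f : V2 → ℝ)
    (hf : DC2On (Tri n) f)
    (hleft : ∀ y : ℤ, 0 ≤ y → y ≤ (n : ℤ) → f (0, y) = 0)
    (htop : ∀ x : ℤ, 0 ≤ x → x ≤ (n : ℤ) → f (x, (n : ℤ)) = 0) :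
    ∀ q ∈ Tri n, f q = 0 := by
  rintro ⟨x, y⟩ ⟨hx, hxy, hyn⟩
  dsimp only at hx hxy hyn
  lift x to ℕ using hx
  induction y, hyn using Int.leInductionDown with
  | base => exact htop x (by lia) hxy
  | pred y hyn ih =>
    have hedge := hf.vertical_edge_eq hleft x (y - 1) hxy (by lia)
    rw [sub_add_cancel] at hedge
    rw [← hedge]
    exact ih (by lia)
end

section
/- Let n ≥ 1 and let a : {1,…,n} × {1,2} → ℝ≥0 be a two-row array. Define f(i,0) = 0, f(i,1) = Σ_{k≤i} a(k,1), f(i,2) = f(i,1) + Σ_{k≤i} a(k,2) for 0 ≤ i ≤ n, and define f′(0,1) = 0 and, for 1 ≤ i ≤ n, f′(i,1) = f(i,1) + max_{1≤k≤i} ( f(k,2) − f(k,1) − f(k−1,1) + f(k−1,0) ) (this is the formula for the D-condensation of a two-row array). Then f′ obeys the octahedron recurrence: for every 1 ≤ i ≤ n, f′(i,1) = max( f′(i−1,1) + f(i,1), f(i,2) + f(i−1,0) ) − f(i−1,1). -/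
/-- for a two-row array `a` (rows `j = 1, 2`, columns `1,…,n`), the function
`f′` given by the explicit formula for the `D`-condensation of `a`,
`f′(i,1) = f(i,1) + max_{1≤k≤i} (f(k,2) − f(k,1) − f(k−1,1) + f(k−1,0))`, `f′(0,1) = 0`,
obeys the octahedron recurrence
`f′(i,1) = max(f′(i−1,1) + f(i,1), f(i,2) + f(i−1,0)) − f(i−1,1)` for `1 ≤ i ≤ n`.
Here `f = ∫∫a`, so `f(i,0) = f0 i = 0`, `f(i,1) = f1 i = Σ_{k≤i} a(k,1)` and
`f(i,2) = f2 i = f1 i + Σ_{k≤i} a(k,2)`. -/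
theorem two_row_condensation_octahedron (n : ℕ) (hn : 1 ≤ n) (a : ℤ → ℤ → ℝ)
    (ha : ∀ i j : ℤ, 1 ≤ i → i ≤ (n : ℤ) → (j = 1 ∨ j = 2) → 0 ≤ a i j)
    (f0 f1 f2 f' : ℤ → ℝ)
    (hf0 : ∀ i : ℤ, f0 i = 0)
    (hf1 : ∀ i : ℤ, f1 i = ∑ k ∈ Finset.Icc (1 : ℤ) i, a k 1)
    (hf2 : ∀ i : ℤ, f2 i = f1 i + ∑ k ∈ Finset.Icc (1 : ℤ) i, a k 2)
    (hf'0 : f' 0 = 0)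
    (hf' : ∀ (i : ℤ) (hi : 1 ≤ i), i ≤ (n : ℤ) →
      f' i = f1 i + (Finset.Icc (1 : ℤ) i).sup' (Finset.nonempty_Icc.mpr hi)
        (fun k => f2 k - f1 k - f1 (k - 1) + f0 (k - 1))) :
    ∀ i : ℤ, 1 ≤ i → i ≤ (n : ℤ) →
      f' i = max (f' (i - 1) + f1 i) (f2 i + f0 (i - 1)) - f1 (i - 1) := by
  intro i hi hin
  rcases hi.eq_or_lt with rfl | hlt
  · have h2 : 0 ≤ a 1 2 := ha 1 2 le_rfl hin (Or.inr rfl)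
    have hf10 : f1 0 = 0 := by simp [hf1]
    have hle : f1 1 ≤ f2 1 := by rw [hf2]; simpa using h2
    rw [hf' 1 le_rfl hin]
    simp [hf0, hf'0, hf10, hle]
  · have hi' : 1 ≤ i - 1 := by omega
    have hIcc : Finset.Icc (1 : ℤ) i = insert i (Finset.Icc (1 : ℤ) (i - 1)) := by
      ext k
      simp only [Finset.mem_Icc, Finset.mem_insert]
      omega
    rw [hf' i hi hin, hf' (i - 1) hi' (by omega), Finset.sup'_congr _ hIcc fun _ _ => rfl,
      Finset.sup'_insert (H := Finset.nonempty_Icc.mpr hi'), ← max_sub_sub_right,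
      ← max_add_add_left, max_comm]
    congr 1 <;> ring
end

section
/- Let n, m ≥ 1 and let a : {1,…,n} × {1,…,m} → ℝ≥0 be an array with integral ∫∫a. Let Q = {(x,y,z) ∈ ℤ³ : 0 ≤ x ≤ n, 0 ≤ y ≤ z ≤ m} and let F : Q → ℝ be the octahedron-recurrence propagation of ∫∫a, defined by: F(0,y,z) = 0, F(x,0,z) = 0, F(x,y,y) = ∫∫a(x,y), and for 1 ≤ x ≤ n and 1 ≤ y < z ≤ m, F(x,y,z) = max( F(x−1,y,z) + F(x,y,z−1), F(x,y+1,z) + F(x−1,y−1,z−1) ) − F(x−1,y,z−1) (this determines F uniquely by induction on x, then z, then decreasing y). Then: (a) the ceiling function g(x,y) := F(x,y,m) is VS-concave on {0,…,n} × {0,…,m}, i.e. g(x−1,y−1) + g(x,y) ≥ g(x,y−1) + g(x−1,y) for all 1 ≤ x ≤ n, 1 ≤ y ≤ m, and g(x−1,y) + g(x,y) ≥ g(x−1,y−1) + g(x,y+1) for all 1 ≤ x ≤ n, 1 ≤ y ≤ m−1; and (b) the right-wall function h(y,z) := F(n,y,z) is HS-concave on the triangle {(y,z) : 0 ≤ y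 ≤ z ≤ m}, i.e. h(y−1,z−1) + h(y,z) ≥ h(y,z−1) + h(y−1,z) and h(y,z−1) + h(y,z) ≥ h(y−1,z−1) + h(y+1,z) for all 1 ≤ y < z ≤ m. -/
/-- The increments `f y - f (y - 1)` and `g y - g (y - 1)` interlace: those of `g` dominate those
of `f` for `1 ≤ y ≤ b`, and that of `f` at `y` dominates that of `g` at `y + 1` for
`1 ≤ y < c`. -/
def IncrementsInterlace (f g : ℤ → ℝ) (b c : ℤ) : Prop :=
  (∀ y : ℤ, 1 ≤ y → y ≤ b → g (y - 1) + f y ≤ f (y - 1) + g y) ∧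
    ∀ y : ℤ, 1 ≤ y → y < c → f (y - 1) + g (y + 1) ≤ f y + g y

/-- One step of the octahedron recurrence: interlacing of the increments on two adjacent faces
of a column propagates to the two opposite faces. -/
theorem IncrementsInterlace.octahedron_step {p q r s : ℤ → ℝ} {z : ℤ}
    (hpq : IncrementsInterlace p q (z - 1) (z - 1))
    (hpr : IncrementsInterlace p r (z - 1) z)
    (hr : r 0 = 0) (hs : s 0 = 0) (hp : p 0 = 0) (hq : q 0 = 0)
    (htop : r z + q (z - 1) ≤ p (z - 1) + s z)
    (hrec : ∀ y : ℤ, 1 ≤ y → y < z →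
      s y = max (r y + q y) (s (y + 1) + p (y - 1)) - p y) :
    IncrementsInterlace r s z z ∧ IncrementsInterlace q s (z - 1) z := by
  obtain ⟨pq₁, pq₂⟩ := hpq
  obtain ⟨pr₁, pr₂⟩ := hpr
  have lower : ∀ y : ℤ, 1 ≤ y → y < z → r y + q y ≤ s y + p y := fun y h₁ h₂ => by
    linarith [hrec y h₁ h₂, le_max_left (r y + q y) (s (y + 1) + p (y - 1))]
  have upper : ∀ y : ℤ, 1 ≤ y → y < z → s (y + 1) + p (y - 1) ≤ s y + p y :=
    fun y h₁ h₂ => by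
      linarith [hrec y h₁ h₂, le_max_right (r y + q y) (s (y + 1) + p (y - 1))]
  have lower_r : ∀ y : ℤ, 1 ≤ y → y ≤ z → r y + q (y - 1) ≤ s y + p (y - 1) := by
    intro y h₁ h₂
    rcases h₂.eq_or_lt with rfl | h₂
    · linarith
    · linarith [lower y h₁ h₂, pq₁ y h₁ (by omega)]
  have lower_q : ∀ y : ℤ, 1 ≤ y → y < z → q y + r (y - 1) ≤ s y + p (y - 1) :=
    fun y h₁ h₂ => by linarith [lower y h₁ h₂, pr₁ y h₁ (by omega)]
  refine ⟨⟨fun y h₁ h₂ => ?_, fun y h₁ h₂ => ?_⟩, fun y h₁ h₂ => ?_, fun y h₁ h₂ => ?_⟩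
  · rcases h₁.eq_or_lt with rfl | h₁
    · have := lower_r 1 le_rfl h₂
      simp only [sub_self] at this ⊢
      linarith
    · have hl := lower_r y h₁.le h₂
      have hr' := pr₂ (y - 1) (by omega) (by omega)
      have hs' := hrec (y - 1) (by omega) (by omega)
      rw [sub_add_cancel] at hr' hs'
      rcases max_cases (r (y - 1) + q (y - 1)) (s y + p (y - 1 - 1)) with ⟨h, -⟩ | ⟨h, -⟩ <;>
        linarith
  · linarith [upper y h₁ h₂, pr₁ y h₁ (by omega)]
  · rcases h₁.eq_or_lt with rfl | h₁
    · have := lower_q 1 le_rfl (by omega)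
      simp only [sub_self] at this ⊢
      linarith
    · have hl := lower_q y h₁.le (by omega)
      have hq' := pq₂ (y - 1) (by omega) (by omega)
      have hs' := hrec (y - 1) (by omega) (by omega)
      rw [sub_add_cancel] at hq' hs'
      rcases max_cases (r (y - 1) + q (y - 1)) (s y + p (y - 1 - 1)) with ⟨h, -⟩ | ⟨h, -⟩ <;>
        linarith
  · linarith [upper y h₁ h₂, pq₁ y h₁ (by omega)]

theorem Int.sum_Icc_one_eq_sum_pred_add {M : Type*} [AddCommMonoid M] (f : ℤ → M) {k : ℤ}
    (hk : 1 ≤ k) :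
    ∑ p ∈ Finset.Icc 1 k, f p = ∑ p ∈ Finset.Icc 1 (k - 1), f p + f k := by
  have h : Finset.Icc 1 k = insert k (Finset.Icc 1 (k - 1)) := by
    ext x
    simp only [Finset.mem_Icc, Finset.mem_insert]
    omega
  rw [h, Finset.sum_insert (by simp), add_comm]


/-- let `a` be a nonnegative `n × m` array with integral `A = ∫∫a`, and let `F`
be the octahedron-recurrence propagation of `A` on the prism
`Q = {0 ≤ x ≤ n, 0 ≤ y ≤ z ≤ m}` with propagation vector `(1,0,1)`: zero initial data on the
faces `x = 0` and `y = 0`, the data `A` on the slope face `y = z`, and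
`F(x,y,z) = max(F(x−1,y,z) + F(x,y,z−1), F(x,y+1,z) + F(x−1,y−1,z−1)) − F(x−1,y,z−1)` for
`1 ≤ x ≤ n`, `1 ≤ y < z ≤ m`.  Then (a) the ceiling function `g(x,y) = F(x,y,m)` is
VS-concave, and (b) the right-wall function `h(y,z) = F(n,y,z)` is HS-concave on the triangle
`{0 ≤ y ≤ z ≤ m}`. -/
theorem octahedron_recurrence_functional_RSK (n m : ℕ) (hn : 1 ≤ n) (hm : 1 ≤ m)
    (a : ℤ → ℤ → ℝ)
    (ha : ∀ i j : ℤ, 1 ≤ i → i ≤ (n : ℤ) → 1 ≤ j → j ≤ (m : ℤ) → 0 ≤ a i j)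
    (A : ℤ → ℤ → ℝ)
    (hA : ∀ i j : ℤ, A i j = ∑ p ∈ Finset.Icc (1 : ℤ) i, ∑ q ∈ Finset.Icc (1 : ℤ) j, a p q)
    (F : ℤ → ℤ → ℤ → ℝ)
    (hshadow : ∀ y z : ℤ, 0 ≤ y → y ≤ z → z ≤ (m : ℤ) → F 0 y z = 0)
    (hfront : ∀ x z : ℤ, 0 ≤ x → x ≤ (n : ℤ) → 0 ≤ z → z ≤ (m : ℤ) → F x 0 z = 0)
    (hslope : ∀ x y : ℤ, 0 ≤ x → x ≤ (n : ℤ) → 0 ≤ y → y ≤ (m : ℤ) → F x y y = A x y)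
    (hrec : ∀ x y z : ℤ, 1 ≤ x → x ≤ (n : ℤ) → 1 ≤ y → y < z → z ≤ (m : ℤ) →
      F x y z = max (F (x - 1) y z + F x y (z - 1))
          (F x (y + 1) z + F (x - 1) (y - 1) (z - 1)) - F (x - 1) y (z - 1)) :
    ((∀ x y : ℤ, 1 ≤ x → x ≤ (n : ℤ) → 1 ≤ y → y ≤ (m : ℤ) →
        F x (y - 1) (m : ℤ) + F (x - 1) y (m : ℤ) ≤
          F (x - 1) (y - 1) (m : ℤ) + F x y (m : ℤ)) ∧
      (∀ x y : ℤ, 1 ≤ x → x ≤ (n : ℤ) → 1 ≤ y → y + 1 ≤ (m : ℤ) →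
        F (x - 1) (y - 1) (m : ℤ) + F x (y + 1) (m : ℤ) ≤
          F (x - 1) y (m : ℤ) + F x y (m : ℤ))) ∧
    ((∀ y z : ℤ, 1 ≤ y → y < z → z ≤ (m : ℤ) →
        F (n : ℤ) y (z - 1) + F (n : ℤ) (y - 1) z ≤
          F (n : ℤ) (y - 1) (z - 1) + F (n : ℤ) y z) ∧
      (∀ y z : ℤ, 1 ≤ y → y < z → z ≤ (m : ℤ) →
        F (n : ℤ) (y - 1) (z - 1) + F (n : ℤ) (y + 1) z ≤
          F (n : ℤ) y (z - 1) + F (n : ℤ) y z)) := by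
  have hAstep : ∀ x y : ℤ, 1 ≤ x → x ≤ n → 1 ≤ y → y ≤ m →
      A (x - 1) y + A x (y - 1) ≤ A (x - 1) (y - 1) + A x y := by
    intro x y hx hxn hy hym
    have h := ha x y hx hxn hy hym
    simp only [hA]
    rw [Int.sum_Icc_one_eq_sum_pred_add _ hx, Int.sum_Icc_one_eq_sum_pred_add _ hx,
      Int.sum_Icc_one_eq_sum_pred_add (a x) hy]
    linarith
  have column : ∀ x : ℕ, (x : ℤ) + 1 ≤ n →
      (∀ z : ℤ, 1 ≤ z → z ≤ m →
        IncrementsInterlace (F x · (z - 1)) (F x · z) (z - 1) z) →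
      ∀ z : ℕ, (z : ℤ) ≤ m →
        IncrementsInterlace (F x · z) (F (x + 1) · z) z z ∧
          (1 ≤ z → IncrementsInterlace (F (x + 1) · ((z : ℤ) - 1)) (F (x + 1) · z) (z - 1) z) := by
    intro x hx hface z
    induction z with
    | zero =>
      refine fun _ => ⟨⟨fun y h₁ h₂ => ?_, fun y h₁ h₂ => ?_⟩, fun h => ?_⟩ <;> omega
    | succ z ih =>
      intro hz
      push_cast at hz ⊢
      have hpq := (ih (by omega)).1
      have hpr := hface (z + 1) (by omega) hz
      have htop := hAstep (x + 1) (z + 1) (by omega) hx (by omega) hz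
      simp only [add_sub_cancel_right] at hpr htop ⊢
      have key := IncrementsInterlace.octahedron_step (p := (F x · z)) (q := (F (x + 1) · z))
        (r := (F x · (z + 1))) (s := (F (x + 1) · (z + 1))) (z := z + 1)
        (by simpa using hpq) (by simpa using hpr)
        (hfront _ _ (by omega) (by omega) (by omega) (by omega))
        (hfront _ _ (by omega) (by omega) (by omega) (by omega))
        (hfront _ _ (by omega) (by omega) (by omega) (by omega))
        (hfront _ _ (by omega) (by omega) (by omega) (by omega))
        (by
          simp only [add_sub_cancel_right]
          rw [hslope _ _ (by omega) (by omega) (by omega) (by omega),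
            hslope _ _ (by omega) (by omega) (by omega) (by omega),
            hslope _ _ (by omega) (by omega) (by omega) (by omega),
            hslope _ _ (by omega) (by omega) (by omega) (by omega)]
          exact htop)
        (fun y h₁ h₂ => by
          simpa using hrec (x + 1) y (z + 1) (by omega) hx h₁ h₂ hz)
      exact ⟨key.1, fun _ => by simpa using key.2⟩
  have horizontal : ∀ x : ℕ, (x : ℤ) ≤ n → ∀ z : ℤ, 1 ≤ z → z ≤ m →
      IncrementsInterlace (F x · (z - 1)) (F x · z) (z - 1) z := by
    intro x
    induction x with
    | zero =>
      refine fun _ z _ hz => ⟨fun y h₁ h₂ => ?_, fun y h₁ h₂ => ?_⟩ <;>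
      · simp only [Nat.cast_zero]
        rw [hshadow _ _ (by omega) (by omega) (by omega),
          hshadow _ _ (by omega) (by omega) (by omega),
          hshadow _ _ (by omega) (by omega) (by omega),
          hshadow _ _ (by omega) (by omega) (by omega)]
    | succ x ih =>
      intro hx z h₁ hz
      push_cast at hx ⊢
      lift z to ℕ using by omega
      exact (column x hx (ih (by omega)) z hz).2 (by omega)
  have vertical : ∀ x : ℤ, 1 ≤ x → x ≤ n →
      IncrementsInterlace (F (x - 1) · m) (F x · m) m m := by
    intro x h₁ hx
    obtain ⟨k, hk⟩ := Int.eq_ofNat_of_zero_le (show 0 ≤ x - 1 by omega)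
    obtain rfl : x = k + 1 := by omega
    simpa using (column k hx (horizontal k (by omega)) m le_rfl).1
  refine ⟨⟨fun x y h₁ h₂ h₃ h₄ => (vertical x h₁ h₂).1 y h₃ h₄,
    fun x y h₁ h₂ h₃ h₄ => (vertical x h₁ h₂).2 y h₃ (by omega)⟩,
    fun y z h₁ h₂ h₃ => (add_comm _ _).trans_le
      ((horizontal n le_rfl z (by omega) h₃).1 y h₁ (by omega)),
    fun y z h₁ h₂ h₃ => (horizontal n le_rfl z (by omega) h₃).2 y h₁ h₂⟩
end

section
/- Let n ≥ 1 and let a : {1,…,n} × {1,…,n} → ℝ≥0 be a square array that is both D-tight and L-tight (bi-tight). Then a is diagonal with weakly decreasing diagonal entries: a(i,j) = 0 whenever i ≠ j, and a(1,1) ≥ a(2,2) ≥ … ≥ a(n,n). -/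
/-- The integral of an array indexed by `ℤ × ℤ`, over `{1, …, i} × {1, …, j}`. -/
noncomputable def arrayIntegral (a : ℤ → ℤ → ℝ) (i j : ℤ) : ℝ :=
  ∑ p ∈ Finset.Icc (1 : ℤ) i, ∑ q ∈ Finset.Icc (1 : ℤ) j, a p q

theorem Int.sum_Icc_succ_top {M : Type*} [AddCommMonoid M] (f : ℤ → M) {k l : ℤ}
    (h : k ≤ l + 1) : ∑ q ∈ Finset.Icc k (l + 1), f q = ∑ q ∈ Finset.Icc k l, f q + f (l + 1) := by
  have : Finset.Icc k (l + 1) = insert (l + 1) (Finset.Icc k l) := by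
    ext x
    simp only [Finset.mem_Icc, Finset.mem_insert]
    omega
  rw [this, Finset.sum_insert (by simp), add_comm]

theorem arrayIntegral_transpose (a : ℤ → ℤ → ℝ) (i j : ℤ) :
    arrayIntegral (fun p q => a q p) i j = arrayIntegral a j i :=
  Finset.sum_comm

theorem arrayIntegral_succ_right (a : ℤ → ℤ → ℝ) (i : ℤ) {j : ℤ} (hj : 0 ≤ j) :
    arrayIntegral a i (j + 1) = arrayIntegral a i j + ∑ p ∈ Finset.Icc (1 : ℤ) i, a p (j + 1) := by
  simp only [arrayIntegral]
  rw [← Finset.sum_add_distrib]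
  exact Finset.sum_congr rfl fun p _ => Int.sum_Icc_succ_top _ (by omega)

/-- `D`-tightness says that partial column sums weakly decrease along diagonals. -/
theorem sum_column_succ_le {n : ℤ} {a : ℤ → ℤ → ℝ}
    (hD : ∀ i j : ℤ, 1 ≤ i → i ≤ n → 1 ≤ j → j + 1 ≤ n →
      arrayIntegral a (i - 1) (j - 1) + arrayIntegral a i (j + 1) ≤
        arrayIntegral a (i - 1) j + arrayIntegral a i j)
    {i j : ℤ} (hi : 0 ≤ i) (hin : i + 1 ≤ n) (hj : 1 ≤ j) (hjn : j + 1 ≤ n) :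
    ∑ p ∈ Finset.Icc (1 : ℤ) (i + 1), a p (j + 1) ≤ ∑ p ∈ Finset.Icc (1 : ℤ) i, a p j := by
  have h := hD (i + 1) j (by omega) hin hj hjn
  have h₁ := arrayIntegral_succ_right a (i + 1) (j := j) (by omega)
  have h₂ := arrayIntegral_succ_right a i (j := j - 1) (by omega)
  simp only [add_sub_cancel_right, sub_add_cancel] at h h₂
  linarith

/-- A nonnegative `D`-tight array vanishes above the diagonal. -/
theorem eq_zero_of_lt_of_tight {n : ℤ} {a : ℤ → ℤ → ℝ}
    (ha : ∀ i j : ℤ, 1 ≤ i → i ≤ n → 1 ≤ j → j ≤ n → 0 ≤ a i j)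
    (hD : ∀ i j : ℤ, 1 ≤ i → i ≤ n → 1 ≤ j → j + 1 ≤ n →
      arrayIntegral a (i - 1) (j - 1) + arrayIntegral a i (j + 1) ≤
        arrayIntegral a (i - 1) j + arrayIntegral a i j)
    {i j : ℤ} (hi : 1 ≤ i) (hij : i < j) (hj : j ≤ n) : a i j = 0 := by
  have column_nonpos : ∀ k : ℕ, ∀ j : ℤ, (k : ℤ) < j → j ≤ n →
      ∑ p ∈ Finset.Icc (1 : ℤ) k, a p j ≤ 0 := by
    intro k
    induction k with
    | zero => simp
    | succ k ih =>
      intro j hkj hjn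
      push_cast at hkj ⊢
      have h := sum_column_succ_le hD (i := k) (j := j - 1)
        (by omega) (by omega) (by omega) (by omega)
      rw [sub_add_cancel] at h
      exact h.trans (ih (j - 1) (by omega) (by omega))
  have h := column_nonpos i.toNat j (by omega) hj
  rw [Int.toNat_of_nonneg (by omega)] at h
  have hnonneg : ∀ p ∈ Finset.Icc (1 : ℤ) i, 0 ≤ a p j := fun p hp => by
    rw [Finset.mem_Icc] at hp
    exact ha p j hp.1 (by omega) (by omega) hj
  exact (Finset.sum_eq_zero_iff_of_nonneg hnonneg).1 (h.antisymm (Finset.sum_nonneg hnonneg)) i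
    (Finset.mem_Icc.2 ⟨hi, le_rfl⟩)

/-- a square array `a` (size `n × n`, nonnegative entries, integral `A = ∫∫a`)
that is both `D`-tight and `L`-tight is diagonal, with weakly decreasing diagonal entries. -/
theorem bitight_array_is_diagonal (n : ℕ) (hn : 1 ≤ n) (a : ℤ → ℤ → ℝ)
    (ha : ∀ i j : ℤ, 1 ≤ i → i ≤ (n : ℤ) → 1 ≤ j → j ≤ (n : ℤ) → 0 ≤ a i j)
    (A : ℤ → ℤ → ℝ)
    (hA : ∀ i j : ℤ, A i j = ∑ p ∈ Finset.Icc (1 : ℤ) i, ∑ q ∈ Finset.Icc (1 : ℤ) j, a p q)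
    (hD : ∀ i j : ℤ, 1 ≤ i → i ≤ (n : ℤ) → 1 ≤ j → j + 1 ≤ (n : ℤ) →
      A (i - 1) (j - 1) + A i (j + 1) ≤ A (i - 1) j + A i j)
    (hL : ∀ i j : ℤ, 1 ≤ i → i + 1 ≤ (n : ℤ) → 1 ≤ j → j ≤ (n : ℤ) →
      A (i - 1) (j - 1) + A (i + 1) j ≤ A i (j - 1) + A i j) :
    (∀ i j : ℤ, 1 ≤ i → i ≤ (n : ℤ) → 1 ≤ j → j ≤ (n : ℤ) → i ≠ j → a i j = 0) ∧
    (∀ i : ℤ, 1 ≤ i → i + 1 ≤ (n : ℤ) → a (i + 1) (i + 1) ≤ a i i) := by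
  obtain rfl : A = arrayIntegral a := funext₂ hA
  have hdiag : ∀ i j : ℤ, 1 ≤ i → i ≤ (n : ℤ) → 1 ≤ j → j ≤ (n : ℤ) → i ≠ j → a i j = 0 := by
    intro i j hi hin hj hjn hij
    rcases hij.lt_or_gt with h | h
    · exact eq_zero_of_lt_of_tight ha hD hi h hjn
    · refine eq_zero_of_lt_of_tight (n := n) (a := fun p q => a q p)
        (fun p q hp hpn hq hqn => ha q p hq hqn hp hpn) (fun p q hp hpn hq hqn => ?_) hj h hin
      simp only [arrayIntegral_transpose]
      exact hL q p hq hqn hp hpn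
  refine ⟨hdiag, fun i hi hin => ?_⟩
  have sum_column : ∀ k : ℤ, 1 ≤ k → k ≤ (n : ℤ) →
      ∑ p ∈ Finset.Icc (1 : ℤ) k, a p k = a k k := fun k hk hkn => by
    refine Finset.sum_eq_single_of_mem k (Finset.mem_Icc.2 ⟨hk, le_rfl⟩) fun p hp hpk => ?_
    rw [Finset.mem_Icc] at hp
    exact hdiag p k hp.1 (by omega) hk hkn hpk
  have h := sum_column_succ_le hD (i := i) (j := i) (by omega) hin hi hin
  rwa [sum_column (i + 1) (by omega) hin, sum_column i hi (by omega)] at h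
end
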